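/- arXiv:1512.07267 — 3 statements merged into one kernel-verified Lean document; each statement's English description precedes it below -/
import Mathlib

section
/- Suppose all k groups are extreme (for each j, y_j = 0 or y_j = n_j, with n_j ≥ 1). Let f be a nonnegative measurable function on (0,∞) with ∫_0^∞ f(r) dr = ∞ (an improper hyper-prior density for r), and let g be a probability density on ℝ^m that is strictly positive on a set of positive measure. Then ∫_{ℝ^m} ∫_0^∞ f(r) · g(β) · L(r, β) dr dβ = ∞, i.e., the posterior is always improper. -/
open MeasureTheory Real Filter Finset

/-- The Beta function `B(a,b) = ∫₀¹ v^(a-1) (1-v)^(b-1) dv`. -/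
noncomputable def betaFn (a b : ℝ) : ℝ :=
  ∫ v in (0:ℝ)..1, v ^ (a - 1) * (1 - v) ^ (b - 1)

/-- The standard logistic function `σ(t) = exp t / (1 + exp t)`. -/
noncomputable def logistic (t : ℝ) : ℝ := Real.exp t / (1 + Real.exp t)

/-- Expected random effect `p_j^E(β) = σ(x_jᵀ β)`. -/
noncomputable def pE {k m : ℕ} (x : Fin k → Fin m → ℝ) (j : Fin k) (β : Fin m → ℝ) : ℝ :=
  logistic (∑ i, x j i * β i)

/-- The Beta-Binomial likelihood
`L(r,β) = ∏ⱼ C(nⱼ,yⱼ) B(yⱼ + r pⱼᴱ, nⱼ - yⱼ + r qⱼᴱ) / B(r pⱼᴱ, r qⱼᴱ)`. -/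
noncomputable def bbL {k m : ℕ} (x : Fin k → Fin m → ℝ) (n y : Fin k → ℕ)
    (r : ℝ) (β : Fin m → ℝ) : ℝ :=
  ∏ j : Fin k,
    ((n j).choose (y j) : ℝ) *
      betaFn ((y j : ℝ) + r * pE x j β) (((n j : ℝ) - (y j : ℝ)) + r * (1 - pE x j β)) /
      betaFn (r * pE x j β) (r * (1 - pE x j β))

theorem betaFn_eq_beta {a b : ℝ} (ha : 0 < a) (hb : 0 < b) :
    betaFn a b = ProbabilityTheory.beta a b := by
  have h : Complex.betaIntegral a b = ((betaFn a b : ℝ) : ℂ) := by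
    rw [Complex.betaIntegral, betaFn, ← intervalIntegral.integral_ofReal]
    refine intervalIntegral.integral_congr fun v hv => ?_
    rw [Set.uIcc_of_le zero_le_one] at hv
    have hv' : 0 ≤ 1 - v := sub_nonneg.2 hv.2
    simp only [Complex.ofReal_mul, Complex.ofReal_cpow hv.1, Complex.ofReal_cpow hv',
      Complex.ofReal_sub, Complex.ofReal_one]
  rw [ProbabilityTheory.beta_eq_betaIntegralReal a b ha hb, h, Complex.ofReal_re]

theorem betaFn_pos {a b : ℝ} (ha : 0 < a) (hb : 0 < b) : 0 < betaFn a b := by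
  rw [betaFn_eq_beta ha hb]
  exact ProbabilityTheory.beta_pos ha hb

theorem betaFn_comm {a b : ℝ} (ha : 0 < a) (hb : 0 < b) : betaFn a b = betaFn b a := by
  rw [betaFn_eq_beta ha hb, betaFn_eq_beta hb ha, ProbabilityTheory.beta,
    ProbabilityTheory.beta, mul_comm, add_comm]

theorem betaFn_add_one_left {a b : ℝ} (ha : 0 < a) (hb : 0 < b) :
    betaFn (a + 1) b = a / (a + b) * betaFn a b := by
  have hab : 0 < a + b := add_pos ha hb
  have hG : Gamma (a + b) ≠ 0 := (Gamma_pos_of_pos hab).ne'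
  rw [betaFn_eq_beta (by positivity) hb, betaFn_eq_beta ha hb, ProbabilityTheory.beta,
    ProbabilityTheory.beta, Gamma_add_one ha.ne', add_right_comm, Gamma_add_one hab.ne']
  field_simp

/-- The `N`-th moment of a Beta distribution is at least the `N`-th power of its mean. -/
theorem pow_mul_betaFn_le {a b : ℝ} (ha : 0 < a) (hb : 0 < b) (N : ℕ) :
    (a / (a + b)) ^ N * betaFn a b ≤ betaFn (N + a) b := by
  induction N with
  | zero => simp
  | succ N ih =>
    have hN : 0 < (N : ℝ) + a := by positivity
    have hratio : a / (a + b) ≤ (N + a) / (N + a + b) := by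
      rw [div_le_div_iff₀ (by positivity) (by positivity)]
      nlinarith [mul_nonneg (Nat.cast_nonneg (α := ℝ) N) hb.le]
    rw [Nat.cast_add_one, add_right_comm, betaFn_add_one_left hN hb, pow_succ', mul_assoc]
    have := betaFn_pos ha hb
    gcongr

theorem logistic_pos (t : ℝ) : 0 < logistic t := by
  unfold logistic
  positivity

theorem logistic_lt_one (t : ℝ) : logistic t < 1 := by
  unfold logistic
  rw [div_lt_one (by positivity)]
  linarith

/-- If every group is extreme, the likelihood is bounded below by a positive constant,
uniformly in `r > 0`. -/
theorem exists_pos_le_bbL {k m : ℕ} (x : Fin k → Fin m → ℝ) (n y : Fin k → ℕ)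
    (hext : ∀ j, y j = 0 ∨ y j = n j) (β : Fin m → ℝ) :
    ∃ c : ℝ, 0 < c ∧ ∀ r : ℝ, 0 < r → c ≤ bbL x n y r β := by
  have hp (j : Fin k) : 0 < pE x j β := logistic_pos _
  have hq (j : Fin k) : 0 < 1 - pE x j β := sub_pos.2 (logistic_lt_one _)
  refine ⟨∏ j, min (pE x j β ^ n j) ((1 - pE x j β) ^ n j),
    Finset.prod_pos fun j _ => lt_min (pow_pos (hp j) _) (pow_pos (hq j) _), fun r hr => ?_⟩
  refine Finset.prod_le_prod
    (fun j _ => (lt_min (pow_pos (hp j) _) (pow_pos (hq j) _)).le) fun j _ => ?_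
  have ha := mul_pos hr (hp j)
  have hb := mul_pos hr (hq j)
  have hmean : r * pE x j β / (r * pE x j β + r * (1 - pE x j β)) = pE x j β := by
    field_simp
    ring
  have hmean' :
      r * (1 - pE x j β) / (r * (1 - pE x j β) + r * pE x j β) = 1 - pE x j β := by
    field_simp
    ring
  rw [le_div_iff₀ (betaFn_pos ha hb)]
  rcases hext j with h | h
  · have key := pow_mul_betaFn_le hb ha (n j)
    rw [hmean', betaFn_comm hb ha, betaFn_comm (by positivity) ha] at key
    simp only [h, Nat.choose_zero_right, Nat.cast_one, one_mul, Nat.cast_zero, zero_add,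
      sub_zero]
    exact (mul_le_mul_of_nonneg_right (min_le_right _ _) (betaFn_pos ha hb).le).trans key
  · have key := pow_mul_betaFn_le ha hb (n j)
    rw [hmean] at key
    simp only [h, Nat.choose_self, Nat.cast_one, one_mul, sub_self, zero_add]
    exact (mul_le_mul_of_nonneg_right (min_le_left _ _) (betaFn_pos ha hb).le).trans key

/-- Theorem 5: all groups extreme, any improper hyper-prior density `f` for `r`
(nonnegative measurable with infinite integral over `(0,∞)`), and any proper hyper-prior
density `g` for `β` that is strictly positive on a set of positive measure. The posterior
is always improper. -/
theorem posterior_improper_all_extreme_improper_r (k m : ℕ) (x : Fin k → Fin m → ℝ)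
    (n y : Fin k → ℕ) (hn : ∀ j, 1 ≤ n j) (hext : ∀ j, y j = 0 ∨ y j = n j)
    (f : ℝ → ℝ) (hfm : Measurable f) (hf0 : ∀ r, 0 ≤ f r)
    (hf1 : ∫⁻ r in Set.Ioi (0:ℝ), ENNReal.ofReal (f r) = ⊤)
    (g : (Fin m → ℝ) → ℝ) (hgm : Measurable g) (hg0 : ∀ β, 0 ≤ g β)
    (hg1 : ∫⁻ β : Fin m → ℝ, ENNReal.ofReal (g β) = 1)
    (hgpos : 0 < volume {β : Fin m → ℝ | 0 < g β}) :
    (∫⁻ β : Fin m → ℝ, ∫⁻ r in Set.Ioi (0:ℝ),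
        ENNReal.ofReal (f r * g β * bbL x n y r β)) = ⊤ := by
  have hinner : ∀ β ∈ {β : Fin m → ℝ | 0 < g β},
      ∫⁻ r in Set.Ioi (0:ℝ), ENNReal.ofReal (f r * g β * bbL x n y r β) = ⊤ := by
    intro β hβ
    obtain ⟨c, hc, hcL⟩ := exists_pos_le_bbL x n y hext β
    have hgc : 0 < g β * c := mul_pos hβ hc
    rw [← top_le_iff]
    calc ⊤ = ENNReal.ofReal (g β * c) * ∫⁻ r in Set.Ioi (0:ℝ), ENNReal.ofReal (f r) := by
          rw [hf1, ENNReal.mul_top (ENNReal.ofReal_pos.2 hgc).ne']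
      _ = ∫⁻ r in Set.Ioi (0:ℝ), ENNReal.ofReal (g β * c) * ENNReal.ofReal (f r) :=
          (lintegral_const_mul' _ _ ENNReal.ofReal_ne_top).symm
      _ ≤ _ := setLIntegral_mono' measurableSet_Ioi fun r hr => by
          rw [← ENNReal.ofReal_mul hgc.le]
          refine ENNReal.ofReal_le_ofReal ?_
          calc g β * c * f r = f r * g β * c := by ring
            _ ≤ _ := mul_le_mul_of_nonneg_left (hcL r hr) (mul_nonneg (hf0 r) (hg0 β))
  have hmeas : MeasurableSet {β : Fin m → ℝ | 0 < g β} := measurableSet_lt measurable_const hgm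
  rw [← top_le_iff]
  calc ⊤ = ∫⁻ _ in {β : Fin m → ℝ | 0 < g β}, (⊤ : ENNReal) := by
        rw [setLIntegral_const, ENNReal.top_mul hgpos.ne']
    _ = ∫⁻ β in {β : Fin m → ℝ | 0 < g β}, ∫⁻ r in Set.Ioi (0:ℝ),
          ENNReal.ofReal (f r * g β * bbL x n y r β) :=
        setLIntegral_congr_fun hmeas fun β hβ => (hinner β hβ).symm
    _ ≤ _ := setLIntegral_le_lintegral _ _
end

section
/- For any data (k ≥ 1 groups with n_j ≥ 1 and y_j ∈ {0,…,n_j}), any covariate vectors x_1,…,x_k ∈ ℝ^m, and any probability density g on ℝ^m that is strictly positive on a set of positive measure, the hyper-prior dr/r on r yields an improper posterior: ∫_{ℝ^m} ∫_0^∞ (1/r) · g(β) · L(r, β) dr dβ = ∞. Moreover, for every fixed β ∈ ℝ^m, already ∫_1^∞ L(r, β)/r dr = ∞, because L(r, β) converges as r → ∞ to the positive constant ∏_{j=1}^k C(n_j, y_j) (p_j^E(β))^{y_j} (q_j^E(β))^{n_j − y_j}. -/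
open MeasureTheory Real Filter Finset

theorem betaFn_add_one_right {a b : ℝ} (ha : 0 < a) (hb : 0 < b) :
    betaFn a (b + 1) = b / (a + b) * betaFn a b := by
  rw [betaFn_eq_beta ha hb, betaFn_eq_beta ha (by positivity)]
  unfold ProbabilityTheory.beta
  have hG : Real.Gamma (a + b) ≠ 0 := (Real.Gamma_pos_of_pos (by positivity)).ne'
  have hab : a + b ≠ 0 := by positivity
  rw [show a + (b + 1) = (a + b) + 1 by ring, Real.Gamma_add_one hb.ne', Real.Gamma_add_one hab]
  field_simp

theorem tendsto_const_add_mul_div_const_add (s t p : ℝ) :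
    Tendsto (fun r : ℝ => (s + r * p) / (t + r)) atTop (nhds p) := by
  have h1 : Tendsto (fun r : ℝ => (s * r⁻¹ + p) / (t * r⁻¹ + 1)) atTop
      (nhds ((s * 0 + p) / (t * 0 + 1))) :=
    ((tendsto_inv_atTop_zero.const_mul s).add_const p).div
      ((tendsto_inv_atTop_zero.const_mul t).add_const 1) (by norm_num)
  have h2 : (s * 0 + p) / (t * 0 + 1) = p := by simp
  rw [h2] at h1
  refine h1.congr' ?_
  filter_upwards [eventually_gt_atTop 0] with r hr
  rw [← mul_div_mul_right (s * r⁻¹ + p) (t * r⁻¹ + 1) hr.ne']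
  congr 1 <;> field_simp

theorem tendsto_betaFn_ratio {p : ℝ} (hp : 0 < p) (hp1 : p < 1) (a b : ℕ) :
    Tendsto (fun r : ℝ => betaFn (a + r * p) (b + r * (1 - p)) / betaFn (r * p) (r * (1 - p)))
      atTop (nhds (p ^ a * (1 - p) ^ b)) := by
  have hq : 0 < 1 - p := sub_pos.2 hp1
  induction a with
  | zero =>
    induction b with
    | zero =>
      refine tendsto_const_nhds.congr' ?_
      filter_upwards [eventually_gt_atTop 0] with r hr
      have := betaFn_pos (mul_pos hr hp) (mul_pos hr hq)
      simp [this.ne']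
    | succ b ih =>
      have h := (tendsto_const_add_mul_div_const_add b b (1 - p)).mul ih
      rw [show p ^ 0 * (1 - p) ^ (b + 1) = (1 - p) * (p ^ 0 * (1 - p) ^ b) by ring]
      refine h.congr' ?_
      filter_upwards [eventually_gt_atTop 0] with r hr
      push_cast
      rw [show (b : ℝ) + 1 + r * (1 - p) = b + r * (1 - p) + 1 by ring,
        betaFn_add_one_right (by positivity) (by positivity), mul_div_assoc,
        show (0 : ℝ) + r * p + (b + r * (1 - p)) = b + r by ring]
  | succ a ih =>
    have h := (tendsto_const_add_mul_div_const_add a (a + b) p).mul ih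
    rw [show p ^ (a + 1) * (1 - p) ^ b = p * (p ^ a * (1 - p) ^ b) by ring]
    refine h.congr' ?_
    filter_upwards [eventually_gt_atTop 0] with r hr
    push_cast
    rw [show (a : ℝ) + 1 + r * p = a + r * p + 1 by ring,
      betaFn_add_one_left (by positivity) (by positivity), mul_div_assoc,
      show (a : ℝ) + r * p + (b + r * (1 - p)) = a + b + r by ring]

theorem tendsto_bbL {k m : ℕ} (x : Fin k → Fin m → ℝ) (n y : Fin k → ℕ)
    (hy : ∀ j, y j ≤ n j) (β : Fin m → ℝ) :
    Tendsto (fun r : ℝ => bbL x n y r β) atTop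
      (nhds (∏ j : Fin k,
        ((n j).choose (y j) : ℝ) * pE x j β ^ y j * (1 - pE x j β) ^ (n j - y j))) := by
  unfold bbL
  refine tendsto_finsetProd _ fun j _ => ?_
  have h := (tendsto_betaFn_ratio (p := pE x j β) (logistic_pos _) (logistic_lt_one _)
    (y j) (n j - y j)).const_mul ((n j).choose (y j) : ℝ)
  simpa only [Nat.cast_sub (hy j), mul_div_assoc, mul_assoc] using h

theorem lintegral_Ioi_div_eq_top {f : ℝ → ℝ} {c : ℝ} (hc : 0 < c)
    (hf : Tendsto f atTop (nhds c)) (a : ℝ) :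
    ∫⁻ r in Set.Ioi a, ENNReal.ofReal (f r / r) = ⊤ := by
  obtain ⟨R, hR⟩ := eventually_atTop.1 (hf.eventually (lt_mem_nhds (half_lt_self hc)))
  set S := max (max a R) 1
  have hS : ∀ r ∈ Set.Ioi S, a < r ∧ R ≤ r ∧ 0 < r := fun r hr =>
    ⟨((le_max_left a R).trans (le_max_left _ _)).trans_lt hr,
      (((le_max_right a R).trans (le_max_left _ _)).trans_lt hr).le,
      (zero_lt_one.trans_le (le_max_right _ _)).trans hr⟩
  have htop : ∫⁻ r in Set.Ioi S, ENNReal.ofReal r⁻¹ = ⊤ := by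
    by_contra h
    refine not_integrableOn_Ioi_inv (a := S) ⟨measurable_inv.aestronglyMeasurable, ?_⟩
    rw [hasFiniteIntegral_iff_ofReal]
    · exact lt_top_iff_ne_top.2 h
    · filter_upwards [ae_restrict_mem measurableSet_Ioi] with r hr
      exact (inv_pos.2 (hS r hr).2.2).le
  rw [eq_top_iff]
  calc (⊤ : ENNReal) = ENNReal.ofReal (c / 2) * ∫⁻ r in Set.Ioi S, ENNReal.ofReal r⁻¹ := by
        rw [htop, ENNReal.mul_top (ENNReal.ofReal_pos.2 (half_pos hc)).ne']
    _ ≤ ∫⁻ r in Set.Ioi S, ENNReal.ofReal (c / 2) * ENNReal.ofReal r⁻¹ :=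
        lintegral_const_mul_le _ _
    _ ≤ ∫⁻ r in Set.Ioi S, ENNReal.ofReal (f r / r) := by
        refine setLIntegral_mono' measurableSet_Ioi fun r hr => ?_
        rw [← ENNReal.ofReal_mul (half_pos hc).le, div_eq_mul_inv (f r)]
        have := (inv_pos.2 (hS r hr).2.2).le
        have := (hR r (hS r hr).2.1).le
        gcongr
    _ ≤ ∫⁻ r in Set.Ioi a, ENNReal.ofReal (f r / r) :=
        lintegral_mono_set fun r hr => (hS r hr).1

/-- Section 3.2: the hyper-prior `dr/r` always yields an improper posterior, for any data
and any proper hyper-prior density `g` on `β` positive on a set of positive measure.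
Moreover, for every fixed `β`, already `∫_1^∞ L(r,β)/r dr = ∞`, because `L(r,β)` converges
as `r → ∞` to the positive constant `∏ⱼ C(nⱼ,yⱼ) (pⱼᴱ)^{yⱼ} (qⱼᴱ)^{nⱼ-yⱼ}`. -/
theorem posterior_improper_dr_over_r (k m : ℕ) (hk : 1 ≤ k) (x : Fin k → Fin m → ℝ)
    (n y : Fin k → ℕ) (hn : ∀ j, 1 ≤ n j) (hy : ∀ j, y j ≤ n j)
    (g : (Fin m → ℝ) → ℝ) (hgm : Measurable g) (hg0 : ∀ β, 0 ≤ g β)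
    (hg1 : ∫⁻ β : Fin m → ℝ, ENNReal.ofReal (g β) = 1)
    (hgpos : 0 < volume {β : Fin m → ℝ | 0 < g β}) :
    (∫⁻ β : Fin m → ℝ, ∫⁻ r in Set.Ioi (0:ℝ),
        ENNReal.ofReal ((1 / r) * g β * bbL x n y r β)) = ⊤ ∧
    ∀ β : Fin m → ℝ,
      (∫⁻ r in Set.Ioi (1:ℝ), ENNReal.ofReal (bbL x n y r β / r)) = ⊤ ∧
      Tendsto (fun r : ℝ => bbL x n y r β) atTop
        (nhds (∏ j : Fin k,
          ((n j).choose (y j) : ℝ) * pE x j β ^ y j * (1 - pE x j β) ^ (n j - y j))) := by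
  have hpos : ∀ β, 0 < ∏ j : Fin k,
      ((n j).choose (y j) : ℝ) * pE x j β ^ y j * (1 - pE x j β) ^ (n j - y j) := fun β =>
    Finset.prod_pos fun j _ => mul_pos (mul_pos (Nat.cast_pos.2 (Nat.choose_pos (hy j)))
      (pow_pos (logistic_pos _) _)) (pow_pos (sub_pos.2 (logistic_lt_one _)) _)
  refine ⟨?_, fun β => ⟨lintegral_Ioi_div_eq_top (hpos β) (tendsto_bbL x n y hy β) 1,
    tendsto_bbL x n y hy β⟩⟩
  have hinner : ∀ β ∈ {β : Fin m → ℝ | 0 < g β}, (⊤ : ENNReal) ≤ ∫⁻ r in Set.Ioi (0:ℝ),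
      ENNReal.ofReal ((1 / r) * g β * bbL x n y r β) := by
    intro β hβ
    rw [← lintegral_Ioi_div_eq_top (mul_pos hβ (hpos β))
      ((tendsto_bbL x n y hy β).const_mul (g β)) 0]
    refine le_of_eq (lintegral_congr fun r => ?_)
    congr 1
    ring
  have hset : MeasurableSet {β : Fin m → ℝ | 0 < g β} := measurableSet_lt measurable_const hgm
  rw [eq_top_iff]
  calc (⊤ : ENNReal) = ∫⁻ _ in {β : Fin m → ℝ | 0 < g β}, ⊤ := by
        rw [setLIntegral_const, ENNReal.top_mul hgpos.ne']
    _ ≤ _ := setLIntegral_mono' hset hinner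
    _ ≤ _ := setLIntegral_le_lintegral _ _
end

section
/- Consider a single group (k = 1) with n_1 = 2 trials and y_1 = 2 successes, intercept-only covariate (p^E(β) = σ(β) for β ∈ ℝ), and the joint hyper-prior dβ dr/(1+r)^2. Then the joint posterior density of (r, β) is proportional to (1 + r·σ(β))·σ(β)/(1+r)^3, and the posterior is improper: ∫_ℝ ∫_0^∞ (1 + r·σ(β))·σ(β)/(1+r)^3 dr dβ = ∞. Equivalently, ∫_ℝ ∫_0^∞ [1/(1+r)^2] · B(2 + r·σ(β), r·(1−σ(β)))/B(r·σ(β), r·(1−σ(β))) dr dβ = ∞. -/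
open MeasureTheory Real Filter Finset

theorem betaFn_two_add_div {a b : ℝ} (ha : 0 < a) (hb : 0 < b) :
    betaFn (2 + a) b / betaFn a b = a * (a + 1) / ((a + b) * (a + b + 1)) := by
  have hab : 0 < a + b := add_pos ha hb
  have h_two (x : ℝ) (hx : 0 < x) :
      Real.Gamma (2 + x) = (x + 1) * (x * Real.Gamma x) := by
    rw [← Real.Gamma_add_one hx.ne', ← Real.Gamma_add_one (by positivity : x + 1 ≠ 0)]
    congr 1
    ring
  rw [betaFn_eq_beta (by positivity) hb, betaFn_eq_beta ha hb, ProbabilityTheory.beta,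
    ProbabilityTheory.beta, add_assoc, h_two a ha, h_two _ hab]
  have h₁ := (Real.Gamma_pos_of_pos ha).ne'
  have h₂ := (Real.Gamma_pos_of_pos hb).ne'
  have h₃ := (Real.Gamma_pos_of_pos hab).ne'
  field_simp

theorem half_le_logistic {t : ℝ} (ht : 0 ≤ t) : 1 / 2 ≤ logistic t := by
  unfold logistic
  rw [div_le_div_iff₀ two_pos (by positivity)]
  linarith [Real.one_le_exp ht]

theorem posterior_density_eq {r : ℝ} (hr : 0 < r) (β : ℝ) :
    (1 / (1 + r) ^ 2) *
        (betaFn (2 + r * logistic β) (r * (1 - logistic β)) /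
          betaFn (r * logistic β) (r * (1 - logistic β)))
      = (1 + r * logistic β) * logistic β / (1 + r) ^ 3 := by
  rw [betaFn_two_add_div (mul_pos hr (logistic_pos β))
    (mul_pos hr (sub_pos.2 (logistic_lt_one β))),
    show r * logistic β + r * (1 - logistic β) = r by ring]
  field_simp
  ring

theorem lintegral_posterior_density_eq_top :
    (∫⁻ β : ℝ, ∫⁻ r in Set.Ioi (0:ℝ),
        ENNReal.ofReal ((1 + r * logistic β) * logistic β / (1 + r) ^ 3)) = ⊤ := by
  have h_inner (β : ℝ) (hβ : β ∈ Set.Ioi (0:ℝ)) :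
      ENNReal.ofReal (1 / 16) ≤ ∫⁻ r in Set.Ioi (0:ℝ),
        ENNReal.ofReal ((1 + r * logistic β) * logistic β / (1 + r) ^ 3) := by
    calc ENNReal.ofReal (1 / 16)
        = ∫⁻ _ in Set.Ioc (0:ℝ) 1, ENNReal.ofReal (1 / 16) := by simp
      _ ≤ ∫⁻ r in Set.Ioc (0:ℝ) 1,
            ENNReal.ofReal ((1 + r * logistic β) * logistic β / (1 + r) ^ 3) := by
          refine setLIntegral_mono' measurableSet_Ioc fun r hr => ENNReal.ofReal_le_ofReal ?_
          have hr₀ : 0 < r := hr.1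
          have h_half : 1 / 2 ≤ logistic β := half_le_logistic (le_of_lt hβ)
          have h_cube : (1 + r) ^ 3 ≤ 2 ^ 3 :=
            pow_le_pow_left₀ (by positivity) (by linarith [hr.2]) 3
          have h_prod : 0 ≤ r * logistic β * logistic β := by
            have := logistic_pos β
            positivity
          rw [le_div_iff₀ (by positivity)]
          linarith
      _ ≤ _ := lintegral_mono_set Set.Ioc_subset_Ioi_self
  refine top_le_iff.1 ?_
  calc (⊤ : ENNReal) = ∫⁻ _ in Set.Ioi (0:ℝ), ENNReal.ofReal (1 / 16) := by
        rw [setLIntegral_const, Real.volume_Ioi, ENNReal.mul_top (by simp)]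
    _ ≤ _ := setLIntegral_mono' measurableSet_Ioi h_inner
    _ ≤ _ := setLIntegral_le_lintegral _ _

/-- Counter-example to Daniels (1999): one group with `n = 2`, `y = 2`, intercept-only
covariate, hyper-prior `dβ dr/(1+r)^2`. The joint posterior density of `(r,β)` is
proportional to `(1 + r σ(β)) σ(β) / (1+r)^3`, and the posterior is improper. -/
theorem daniels_counterexample :
    (∃ c : ℝ, 0 < c ∧
      ∀ r : ℝ, 0 < r → ∀ β : ℝ,
        (1 / (1 + r) ^ 2) *
            (betaFn (2 + r * logistic β) (r * (1 - logistic β)) /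
              betaFn (r * logistic β) (r * (1 - logistic β)))
          = c * ((1 + r * logistic β) * logistic β / (1 + r) ^ 3)) ∧
    (∫⁻ β : ℝ, ∫⁻ r in Set.Ioi (0:ℝ),
        ENNReal.ofReal ((1 + r * logistic β) * logistic β / (1 + r) ^ 3)) = ⊤ ∧
    (∫⁻ β : ℝ, ∫⁻ r in Set.Ioi (0:ℝ),
        ENNReal.ofReal ((1 / (1 + r) ^ 2) *
          (betaFn (2 + r * logistic β) (r * (1 - logistic β)) /
            betaFn (r * logistic β) (r * (1 - logistic β))))) = ⊤ := by
  refine ⟨⟨1, one_pos, fun r hr β => ?_⟩, lintegral_posterior_density_eq_top, ?_⟩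
  · rw [one_mul, posterior_density_eq hr]
  · rw [← lintegral_posterior_density_eq_top]
    refine lintegral_congr fun β => setLIntegral_congr_fun measurableSet_Ioi fun r hr => ?_
    exact congrArg ENNReal.ofReal (posterior_density_eq hr β)
end
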